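/- arXiv:2203.06075 — 5 statements merged into one kernel-verified Lean document; each statement's English description precedes it below -/
import Mathlib

section
/- Neither the language K' over A₃ nor its complement {w : List A₃ | w ∉ K'} is recognized by a Σ₂ circuit family. (Hence K' lies outside the class ÂC⁰₂ = Σ₂[arb] ∪ Π₂[arb] of depth-2 polynomial-size circuits with constant-arity input functions.) -/
/-- A predicate on words (functions `ι → A`) is `k`-local if its value is
determined by the letters at some fixed set of at most `k` positions. -/
def KLocal {ι A : Type*} (k : ℕ) (g : (ι → A) → Prop) : Prop :=
  ∃ P : Finset ι, P.card ≤ k ∧ ∀ w v : ι → A, (∀ p ∈ P, w p = v p) → (g w ↔ g v)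

/-- An `(s,k)`-Σ₂-circuit: an OR of at most `s` ANDs of `k`-local predicates. -/
def Sigma2Circuit {ι A : Type*} (s k : ℕ) (C : (ι → A) → Prop) : Prop :=
  ∃ s' : ℕ, s' ≤ s ∧ ∃ J : Fin s' → Type, ∃ g : ∀ i : Fin s', J i → ((ι → A) → Prop),
    (∀ i j, KLocal k (g i j)) ∧ ∀ w, C w ↔ ∃ i, ∀ j, g i j w

/-- `u` is a `k`-limit for `F`: any `k` positions of `u` are matched by some word of `F`. -/
def KLimit {ι A : Type*} (k : ℕ) (F : Set (ι → A)) (u : ι → A) : Prop :=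
  ∀ P : Finset ι, P.card ≤ k → ∃ v ∈ F, ∀ p ∈ P, u p = v p

/-- A language is recognized by a Σ₂ circuit family:
polynomial-size Σ₂ circuits with constant top fan-in (locality). -/
def RecSigma2 {A : Type*} (L : Language A) : Prop :=
  ∃ k c d : ℕ, ∀ n : ℕ, ∃ C : (Fin n → A) → Prop,
    Sigma2Circuit (c * (n + 1) ^ d) k C ∧ ∀ w : Fin n → A, C w ↔ List.ofFn w ∈ L

/-- The three-letter alphabet, with letters `la = a`, `lb = b`, `lc = c` (the neutral letter). -/
abbrev A₃ : Type := Fin 3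
def la : A₃ := 0
def lb : A₃ := 1
def lc : A₃ := 2

open RegularExpression in
/-- The regular expression `(a·c*·b + c)*`. -/
def Kexp : RegularExpression A₃ :=
  (char la * (char lc).star * char lb + char lc).star

/-- The language `K = (a·c*·b + c)*`. -/
def Klang : Language A₃ := Kexp.matches'

open RegularExpression in
/-- The regular expression for `K' = K·(b·c*·b)·(a + b + c)*`. -/
def K'exp : RegularExpression A₃ :=
  Kexp * (char lb * (char lc).star * char lb) * (char la + char lb + char lc).star

/-- The language `K'`. -/
def K'lang : Language A₃ := K'exp.matches'

/-- The states of a deterministic automaton for the language `K'lang`. -/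
inductive K'State : Type
  | zero | one | minus | accept | reject

namespace K'State

/-- The transition function of the automaton. -/
def step : K'State → A₃ → K'State
  | zero, 0 => one
  | zero, 1 => minus
  | zero, 2 => zero
  | one, 0 => reject
  | one, 1 => zero
  | one, 2 => one
  | minus, 0 => reject
  | minus, 1 => accept
  | minus, 2 => minus
  | accept, _ => accept
  | reject, _ => reject

theorem step_lc (s : K'State) : step s lc = s := by cases s <;> rfl

theorem foldl_accept (w : List A₃) : w.foldl step accept = accept := by
  induction w with
  | nil => rfl
  | cons x w ih => exact ih

theorem foldl_reject (w : List A₃) : w.foldl step reject = reject := by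
  induction w with
  | nil => rfl
  | cons x w ih => exact ih

theorem foldl_replicate_lc (n : ℕ) (s : K'State) :
    (List.replicate n lc).foldl step s = s := by
  induction n with
  | zero => rfl
  | succ n ih => rw [List.replicate_succ, List.foldl_cons, step_lc, ih]

/-- A run of the automaton is determined by any sequence of states respecting the transitions. -/
theorem foldl_ofFn {n : ℕ} (σ : ℕ → K'State) (f : Fin n → A₃)
    (h : ∀ t : Fin n, step (σ t) (f t) = σ (t + 1)) :
    (List.ofFn f).foldl step (σ 0) = σ n := by
  induction n with
  | zero => rfl
  | succ n ih =>
    rw [List.ofFn_succ_last, List.foldl_append, ih _ fun t => h t.castSucc]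
    exact h (Fin.last n)

end K'State

open K'State

theorem mem_star_lc {w : List A₃} :
    w ∈ (RegularExpression.char lc).star.matches' ↔ ∃ n, w = List.replicate n lc := by
  rw [RegularExpression.matches'_star, Language.mem_kstar]
  constructor
  · rintro ⟨L, rfl, hL⟩
    refine ⟨L.flatten.length, List.eq_replicate_iff.2 ⟨rfl, fun y hy => ?_⟩⟩
    obtain ⟨l, hl, hyl⟩ := List.mem_flatten.1 hy
    obtain rfl : l = [lc] := hL l hl
    simpa using hyl
  · rintro ⟨n, rfl⟩
    refine ⟨List.replicate n [lc], by simp, fun y hy => ?_⟩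
    exact (List.eq_of_mem_replicate hy : y = [lc])

theorem mem_star_all (w : List A₃) :
    w ∈ (RegularExpression.char la + RegularExpression.char lb +
      RegularExpression.char lc).star.matches' := by
  rw [RegularExpression.matches'_star, Language.mem_kstar]
  refine ⟨w.map fun x => [x], by simp [← List.flatMap_def], fun y hy => ?_⟩
  obtain ⟨x, -, rfl⟩ := List.mem_map.1 hy
  fin_cases x
  · exact Or.inl (Or.inl rfl)
  · exact Or.inl (Or.inr rfl)
  · exact Or.inr rfl

theorem mem_ab_factor {w : List A₃} (x y : A₃) :
    w ∈ (RegularExpression.char x * (RegularExpression.char lc).star *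
      RegularExpression.char y).matches' ↔ ∃ n, w = x :: (List.replicate n lc ++ [y]) := by
  rw [RegularExpression.matches'_mul, RegularExpression.matches'_mul]
  constructor
  · rintro ⟨_, ⟨_, rfl, v, hv, rfl⟩, _, rfl, rfl⟩
    obtain ⟨n, rfl⟩ := mem_star_lc.1 hv
    exact ⟨n, by simp⟩
  · rintro ⟨n, rfl⟩
    exact ⟨x :: List.replicate n lc, ⟨[x], rfl, _, mem_star_lc.2 ⟨n, rfl⟩, rfl⟩, [y], rfl, by simp⟩

theorem mem_K'lang {w : List A₃} :
    w ∈ K'lang ↔ ∃ u ∈ Klang, ∃ n v, w = u ++ lb :: (List.replicate n lc ++ lb :: v) := by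
  constructor
  · rintro ⟨_, ⟨u, hu, t, ht, rfl⟩, v, -, rfl⟩
    obtain ⟨n, rfl⟩ := (mem_ab_factor lb lb).1 ht
    exact ⟨u, hu, n, v, by simp⟩
  · rintro ⟨u, hu, n, v, rfl⟩
    exact ⟨_, ⟨u, hu, _, (mem_ab_factor lb lb).2 ⟨n, rfl⟩, rfl⟩, v, mem_star_all v, by simp⟩

theorem nil_mem_Klang : [] ∈ Klang := Language.nil_mem_kstar _

theorem append_mem_Klang {u w : List A₃} (hw : w ∈ Klang)
    (hu : u = [lc] ∨ ∃ n, u = la :: (List.replicate n lc ++ [lb])) : u ++ w ∈ Klang := by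
  obtain ⟨L, rfl, hL⟩ := Language.mem_kstar.1 hw
  refine Language.mem_kstar.2 ⟨u :: L, rfl, List.forall_mem_cons.2 ⟨?_, hL⟩⟩
  rcases hu with h | h
  · exact Or.inr h
  · exact Or.inl ((mem_ab_factor la lb).2 h)

theorem foldl_of_mem_Klang {w : List A₃} (hw : w ∈ Klang) : w.foldl step zero = zero := by
  obtain ⟨L, rfl, hL⟩ := Language.mem_kstar.1 hw
  clear hw
  induction L with
  | nil => rfl
  | cons u L ih =>
    rw [List.flatten_cons, List.foldl_append]
    have hu : u.foldl step zero = zero := by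
      rcases hL u (by simp) with h | h
      · obtain ⟨n, rfl⟩ := (mem_ab_factor la lb).1 h
        rw [List.foldl_cons, List.foldl_append, foldl_replicate_lc]
        rfl
      · obtain rfl : u = [lc] := h
        rfl
    rw [hu]
    exact ih fun y hy => hL y (List.mem_cons_of_mem _ hy)

theorem of_foldl_eq_accept (w : List A₃) :
    (w.foldl step zero = accept → w ∈ K'lang) ∧
    (w.foldl step one = accept → ∃ n, ∃ v ∈ K'lang, w = List.replicate n lc ++ lb :: v) ∧
    (w.foldl step minus = accept → ∃ n v, w = List.replicate n lc ++ lb :: v) := by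
  induction w with
  | nil => exact ⟨nofun, nofun, nofun⟩
  | cons x w ih =>
    obtain ⟨h0, h1, hm⟩ := ih
    fin_cases x
    · refine ⟨fun h => ?_, fun h => ?_, fun h => ?_⟩
      · obtain ⟨n, v, hv, rfl⟩ := h1 h
        obtain ⟨u, hu, n', v', rfl⟩ := mem_K'lang.1 hv
        refine mem_K'lang.2 ⟨_, append_mem_Klang hu (Or.inr ⟨n, rfl⟩), n', v', ?_⟩
        simp [la]
      · exact absurd ((foldl_reject w).symm.trans h) nofun
      · exact absurd ((foldl_reject w).symm.trans h) nofun
    · refine ⟨fun h => ?_, fun h => ⟨0, w, h0 h, rfl⟩, fun h => ⟨0, w, rfl⟩⟩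
      obtain ⟨n, v, rfl⟩ := hm h
      exact mem_K'lang.2 ⟨[], nil_mem_Klang, n, v, rfl⟩
    · refine ⟨fun h => ?_, fun h => ?_, fun h => ?_⟩
      · obtain ⟨u, hu, n', v', rfl⟩ := mem_K'lang.1 (h0 h)
        exact mem_K'lang.2 ⟨_, append_mem_Klang hu (Or.inl rfl), n', v', rfl⟩
      · obtain ⟨n, v, hv, rfl⟩ := h1 h
        exact ⟨n + 1, v, hv, rfl⟩
      · obtain ⟨n, v, rfl⟩ := hm h
        exact ⟨n + 1, v, rfl⟩

theorem mem_K'lang_iff_foldl {w : List A₃} : w ∈ K'lang ↔ w.foldl step zero = accept := by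
  refine ⟨fun h => ?_, (of_foldl_eq_accept w).1⟩
  obtain ⟨u, hu, n, v, rfl⟩ := mem_K'lang.1 h
  rw [List.foldl_append, foldl_of_mem_Klang hu, List.foldl_cons, List.foldl_append,
    foldl_replicate_lc]
  exact foldl_accept v

/-- A digraph with out-degrees at most `k` has large independent sets. -/
theorem exists_independent_subset {α : Type*} [DecidableEq α] {k : ℕ} (Q : α → Finset α)
    (hQ : ∀ i, (Q i).card ≤ k) (hself : ∀ i, i ∉ Q i) (t : ℕ) (S : Finset α)
    (hS : t * (2 * k + 1) ≤ S.card) :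
    ∃ I ⊆ S, I.card = t ∧ ∀ i ∈ I, ∀ j ∈ I, j ∉ Q i := by
  induction t generalizing S with
  | zero => exact ⟨∅, by simp, rfl, by simp⟩
  | succ t ih =>
    have hne : S.Nonempty := Finset.card_pos.1 (by nlinarith)
    obtain ⟨j, hj, hjk⟩ : ∃ j ∈ S, (S.filter fun i => j ∈ Q i).card ≤ k := by
      refine Finset.exists_le_of_sum_le hne ?_
      calc ∑ j ∈ S, (S.filter fun i => j ∈ Q i).card
          = ∑ i ∈ S, (S.filter fun j => j ∈ Q i).card :=
            (Finset.sum_card_bipartiteAbove_eq_sum_card_bipartiteBelow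
              (fun i j => j ∈ Q i)).symm
        _ ≤ ∑ _i ∈ S, k := Finset.sum_le_sum fun i _ =>
            (Finset.card_le_card fun j hj => (Finset.mem_filter.1 hj).2).trans (hQ i)
    obtain ⟨I, hIS, hIt, hI⟩ := ih (S \ ({j} ∪ (Q j ∪ S.filter fun i => j ∈ Q i))) (by
      have h1 := Finset.le_card_sdiff ({j} ∪ (Q j ∪ S.filter fun i => j ∈ Q i)) S
      have h2 := Finset.card_union_le {j} (Q j ∪ S.filter fun i => j ∈ Q i)
      have h3 := Finset.card_union_le (Q j) (S.filter fun i => j ∈ Q i)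
      have h4 := hQ j
      rw [Finset.card_singleton] at h2
      rw [Nat.succ_mul] at hS
      omega)
    have key : ∀ i ∈ I, i ∈ S ∧ i ≠ j ∧ i ∉ Q j ∧ j ∉ Q i := by
      intro i hi
      have := hIS hi
      simp only [Finset.mem_sdiff, Finset.mem_union, Finset.mem_singleton, Finset.mem_filter,
        not_or, not_and] at this
      exact ⟨this.1, this.2.1, this.2.2.1, this.2.2.2 this.1⟩
    refine ⟨insert j I, ?_, ?_, ?_⟩
    · exact Finset.insert_subset hj fun i hi => (key i hi).1
    · rw [Finset.card_insert_of_notMem fun h => (key j h).2.1 rfl, hIt]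
    · intro i hi i' hi'
      rw [Finset.mem_insert] at hi hi'
      rcases hi with rfl | hi <;> rcases hi' with rfl | hi'
      · exact hself _
      · exact (key _ hi').2.2.1
      · exact (key _ hi).2.2.2
      · exact hI _ hi _ hi'

/-- If, within `G`, each coordinate `i ∈ I` is determined up to `k` values by the coordinates
outside `I`, then `G` is small. -/
theorem card_le_of_determined {m B k : ℕ} (G : Finset (Fin m → Fin B)) (I : Finset (Fin m))
    (h : ∀ x ∈ G, ∀ i ∈ I, ∃ Z : Finset (Fin B), Z.card ≤ k ∧
      ∀ v ∈ G, (∀ q ∉ I, v q = x q) → v i ∈ Z) :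
    G.card ≤ k ^ I.card * B ^ (m - I.card) := by
  classical
  let ρ : (Fin m → Fin B) → ({q // q ∉ I} → Fin B) := fun x q => x q
  have hfib : ∀ y ∈ G.image ρ, (G.filter fun x => ρ x = y).card ≤ k ^ I.card := by
    intro y hy
    obtain ⟨x, hx, rfl⟩ := Finset.mem_image.1 hy
    choose! Z hZ hZmem using h x hx
    calc (G.filter fun v => ρ v = ρ x).card
        ≤ (Fintype.piFinset fun i : I => Z i).card := by
          refine Finset.card_le_card_of_injOn (fun v i => v i) ?_ ?_
          · intro v hv
            obtain ⟨hvG, hvx⟩ := Finset.mem_filter.1 hv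
            exact Fintype.mem_piFinset.2 fun i =>
              hZmem i i.2 v hvG fun q hq => congrFun hvx ⟨q, hq⟩
          · intro v hv v' hv' hvv'
            have e := (Finset.mem_filter.1 hv).2.trans (Finset.mem_filter.1 hv').2.symm
            funext q
            by_cases hq : q ∈ I
            · exact congrFun hvv' ⟨q, hq⟩
            · exact congrFun e ⟨q, hq⟩
      _ = ∏ i : I, (Z i).card := Fintype.card_piFinset _
      _ ≤ ∏ _i : I, k := Finset.prod_le_prod' fun i _ => hZ i i.2
      _ = k ^ I.card := by simp
  refine (Finset.card_le_mul_card_image G _ hfib).trans (Nat.mul_le_mul_left _ ?_)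
  refine (Finset.card_le_univ _).trans (le_of_eq ?_)
  rw [Fintype.card_fun, Fintype.card_fin, Fintype.card_subtype_compl, Fintype.card_fin,
    Fintype.card_coe]

/-- A Σ₂-circuit accepting all `V x`, for `x` in a large product, also accepts some `U i x`,
where `U i x` is obtained from `V x` by blurring the coordinate `i`. -/
theorem Sigma2Circuit.exists_limit {ι A : Type*} {s k m B t : ℕ} {C : (ι → A) → Prop}
    (hC : Sigma2Circuit s k C) (V : (Fin m → Fin B) → ι → A)
    (U : Fin m → (Fin m → Fin B) → ι → A)
    (hVU : ∀ p, ∃ (j : Fin m) (z : Fin B), ∀ i x v,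
      (j ≠ i → v j = x j → V v p = U i x p) ∧ (j = i → v i ≠ z → V v p = U i x p))
    (ht : 0 < t) (hm : t * (2 * k + 1) ≤ m) (hB : s * (2 ^ m) ^ m * k ^ t < B ^ t)
    (hV : ∀ x, C (V x)) : ∃ i x, C (U i x) := by
  classical
  by_contra! hU
  obtain ⟨s', hs', J, g, hg, hCg⟩ := hC
  choose γ hγ using fun x => (hCg _).1 (hV x)
  choose blk z hz using hVU
  have hdet : ∀ x i, ∃ Q : Finset (Fin m), Q.card ≤ k ∧ i ∉ Q ∧ ∃ Z : Finset (Fin B),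
      Z.card ≤ k ∧ ∀ v, γ v = γ x → (∀ q ∈ Q, v q = x q) → v i ∈ Z := by
    intro x i
    obtain ⟨j, hj⟩ : ∃ j, ¬ g (γ x) j (U i x) := by
      by_contra! h
      exact hU i x ((hCg _).2 ⟨γ x, h⟩)
    obtain ⟨P, hP, hloc⟩ := hg (γ x) j
    refine ⟨(P.image blk).erase i, (Finset.card_erase_le.trans Finset.card_image_le).trans hP,
      Finset.notMem_erase _ _, P.image z, Finset.card_image_le.trans hP, fun v hvx hvQ => ?_⟩
    by_contra hvi
    have hgv : ∀ j, g (γ x) j (V v) := hvx ▸ hγ v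
    refine hj ((hloc (V v) (U i x) fun p hp => ?_).1 (hgv j))
    by_cases hpi : blk p = i
    · exact (hz p i x v).2 hpi fun e => hvi (e ▸ Finset.mem_image_of_mem z hp)
    · exact (hz p i x v).1 hpi
        (hvQ _ (Finset.mem_erase.2 ⟨hpi, Finset.mem_image_of_mem blk hp⟩))
  choose Q hQ hself Z hZ hdet using hdet
  have hfib : ∀ y : Fin s' × (Fin m → Finset (Fin m)),
      (Finset.univ.filter fun x => (γ x, Q x) = y).card ≤ k ^ t * B ^ (m - t) := by
    rintro ⟨r, R⟩
    rcases Finset.eq_empty_or_nonempty (Finset.univ.filter fun x => (γ x, Q x) = (r, R)) with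
      h | ⟨x₀, hx₀⟩
    · rw [h]
      exact Nat.zero_le _
    obtain ⟨-, hx₀⟩ := Finset.mem_filter.1 hx₀
    obtain ⟨rfl, rfl⟩ := Prod.mk.inj hx₀
    obtain ⟨I, -, rfl, hI⟩ := exists_independent_subset (Q x₀) (hQ x₀) (hself x₀) t Finset.univ
      (by simpa using hm)
    refine card_le_of_determined _ I fun x hx i hi => ⟨Z x i, hZ x i, fun v hv hvx => ?_⟩
    obtain ⟨hxγ, hxQ⟩ := Prod.mk.inj (Finset.mem_filter.1 hx).2
    obtain ⟨hvγ, hvQ⟩ := Prod.mk.inj (Finset.mem_filter.1 hv).2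
    refine hdet x i v (hvγ.trans hxγ.symm) fun q hq => hvx q fun hqI => ?_
    exact hI i hi q hqI (hxQ ▸ hq)
  have hcard : B ^ m ≤ k ^ t * B ^ (m - t) * (s' * (2 ^ m) ^ m) := by
    have := Finset.card_le_mul_card_image_of_maps_to
      (f := fun x => (γ x, Q x)) (s := Finset.univ) (t := Finset.univ)
      (fun _ _ => Finset.mem_univ _) _ fun y _ => hfib y
    simpa [Fintype.card_finset] using this
  have htm : t ≤ m := (Nat.le_mul_of_pos_right t (by omega)).trans hm
  have hBpos : 0 < B ^ (m - t) := by
    refine Nat.pow_pos (Nat.pos_of_ne_zero ?_)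
    rintro rfl
    simp [ht.ne'] at hB
  refine absurd hcard (not_le.2 ?_)
  calc k ^ t * B ^ (m - t) * (s' * (2 ^ m) ^ m)
      = s' * (2 ^ m) ^ m * k ^ t * B ^ (m - t) := by ring
    _ ≤ s * (2 ^ m) ^ m * k ^ t * B ^ (m - t) := by gcongr
    _ < B ^ t * B ^ (m - t) := Nat.mul_lt_mul_of_pos_right hB hBpos
    _ = B ^ m := by rw [← pow_add, Nat.add_sub_cancel' htm]

/-- The block of length `2 * B + 2`, made of two halves of length `B + 1`, having the letter `q`
at offset `e` in each half and the neutral letter elsewhere. -/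
def sparseBlock (B e : ℕ) (q : A₃) (t : ℕ) : A₃ :=
  if t = e ∨ t = B + 1 + e then q else lc

/-- The block obtained from `sparseBlock B e q` by writing `p` at offset `y` in each half. -/
def denseBlock (B e : ℕ) (p q : A₃) (y t : ℕ) : A₃ :=
  if t = y ∨ t = B + 1 + y then p else sparseBlock B e q t

/-- The concatenation of `m` blocks of length `l`, followed by `r` twice. -/
def blockWord {m l : ℕ} (W : Fin m → ℕ → A₃) (r : A₃) : Fin (m * l + 2) → A₃ :=
  Fin.append (fun p : Fin (m * l) => W p.divNat p.modNat) fun _ => r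

theorem ofFn_blockWord {m l : ℕ} (W : Fin m → ℕ → A₃) (r : A₃) :
    List.ofFn (blockWord (l := l) W r) =
      (List.ofFn fun i => List.ofFn fun t : Fin l => W i t).flatten ++ [r, r] := by
  rw [blockWord, List.ofFn_fin_append, List.ofFn_mul]
  congr 2
  congr 1
  funext i
  congr 1
  funext t
  have hl : 0 < l := t.pos
  congr 1
  · ext
    simp [Fin.divNat, Nat.add_div_of_dvd_right, Nat.div_eq_of_lt t.2, hl]
  · simp [Fin.modNat, Nat.mod_eq_of_lt t.2]

/-- A language with Σ₂ circuits that contains all concatenations of dense blocks contains such a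
concatenation in which one block has been replaced by the sparse one. -/
theorem RecSigma2.exists_sparse {L : Language A₃} (hL : RecSigma2 L) (δ : ℕ)
    (e : ℕ → ℕ) (p q r : A₃)
    (h : ∀ (m B : ℕ) (x : Fin m → Fin B), List.ofFn (blockWord (l := 2 * B + 2)
      (fun i => denseBlock B (e B) p q (x i + δ)) r) ∈ L) :
    ∃ (m B : ℕ) (i : Fin m) (x : Fin m → Fin B), List.ofFn (blockWord (l := 2 * B + 2)
      (Function.update (fun i => denseBlock B (e B) p q (x i + δ)) i
        (sparseBlock B (e B) q)) r) ∈ L := by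
  obtain ⟨k, c, d, hC⟩ := hL
  obtain ⟨m, hm⟩ : ∃ m, m = (d + 1) * (2 * k + 1) := ⟨_, rfl⟩
  obtain ⟨B, hB⟩ : ∃ B, B = c * (4 * m + 3) ^ d * (2 ^ m) ^ m * k ^ (d + 1) + 1 := ⟨_, rfl⟩
  have hm0 : 0 < m := hm ▸ by positivity
  have hB0 : 0 < B := hB ▸ by positivity
  obtain ⟨C, hCs, hCL⟩ := hC (m * (2 * B + 2) + 2)
  have hlarge : c * (m * (2 * B + 2) + 2 + 1) ^ d * (2 ^ m) ^ m * k ^ (d + 1) < B ^ (d + 1) := by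
    calc c * (m * (2 * B + 2) + 2 + 1) ^ d * (2 ^ m) ^ m * k ^ (d + 1)
        ≤ c * ((4 * m + 3) * B) ^ d * (2 ^ m) ^ m * k ^ (d + 1) := by
          gcongr
          nlinarith
      _ = B ^ d * (c * (4 * m + 3) ^ d * (2 ^ m) ^ m * k ^ (d + 1)) := by rw [mul_pow]; ring
      _ < B ^ d * B := Nat.mul_lt_mul_of_pos_left (by omega) (by positivity)
      _ = B ^ (d + 1) := (pow_succ _ _).symm
  obtain ⟨i, x, hix⟩ := hCs.exists_limit (m := m) (B := B) (t := d + 1)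
    (fun x => blockWord (fun i => denseBlock B (e B) p q (x i + δ)) r)
    (fun i x => blockWord (Function.update (fun i => denseBlock B (e B) p q (x i + δ)) i
      (sparseBlock B (e B) q)) r)
    (fun s => by
      induction s using Fin.addCases with
      | right s =>
        exact ⟨⟨0, hm0⟩, ⟨0, hB0⟩, fun i x v => by simp [blockWord]⟩
      | left s =>
        obtain ⟨z, hz⟩ : ∃ z : Fin B, ∀ y : Fin B, y ≠ z →
            ¬ ((s.modNat : ℕ) = y + δ ∨ (s.modNat : ℕ) = B + 1 + (y + δ)) := by
          by_cases hy : ∃ y : Fin B, (s.modNat : ℕ) = y + δ ∨ (s.modNat : ℕ) = B + 1 + (y + δ)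
          · obtain ⟨z, hz⟩ := hy
            refine ⟨z, fun y hyz h => hyz (Fin.ext ?_)⟩
            have := y.2
            have := z.2
            omega
          · exact ⟨⟨0, hB0⟩, fun y _ h => hy ⟨y, h⟩⟩
        refine ⟨s.divNat, z, fun i x v => ⟨fun hi hv => ?_, fun hi hv => ?_⟩⟩
        · simp [blockWord, Function.update_of_ne hi, hv]
        · simp only [blockWord, Fin.append_left, hi, Function.update_self, denseBlock]
          exact if_neg (hz _ hv))
    d.succ_pos hm.ge hlarge fun x => (hCL _).2 (h m B x)
  exact ⟨m, B, i, x, (hCL _).1 hix⟩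

theorem foldl_flatten_eq_self {s : K'State} (l : List (List A₃))
    (h : ∀ w ∈ l, w.foldl step s = s) : l.flatten.foldl step s = s := by
  induction l with
  | nil => rfl
  | cons w l ih =>
    rw [List.flatten_cons, List.foldl_append, h w (by simp)]
    exact ih fun y hy => h y (List.mem_cons_of_mem _ hy)

theorem foldl_flatten_eq_sink {s u : K'State} (hu : ∀ w : List A₃, w.foldl step u = u)
    (l : List (List A₃)) (h : ∀ w ∈ l, w.foldl step s = s ∨ w.foldl step s = u)
    (hl : ∃ w ∈ l, w.foldl step s = u) : l.flatten.foldl step s = u := by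
  induction l with
  | nil => simp at hl
  | cons w l ih =>
    rw [List.flatten_cons, List.foldl_append]
    by_cases hw : w.foldl step s = u
    · rw [hw, hu]
    · rw [(h w (by simp)).resolve_right hw]
      refine ih (fun y hy => h y (List.mem_cons_of_mem _ hy)) ?_
      simpa [hw] using hl

theorem foldl_blockWord_eq {m l : ℕ} {W : Fin m → ℕ → A₃} {s : K'State}
    (h : ∀ i, (List.ofFn fun t : Fin l => W i t).foldl step s = s) (r : A₃) :
    (List.ofFn (blockWord (l := l) W r)).foldl step s = step (step s r) r := by
  rw [ofFn_blockWord, List.foldl_append, foldl_flatten_eq_self _ (List.forall_mem_ofFn_iff.2 h)]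
  rfl

theorem foldl_blockWord_update_eq {m l : ℕ} {W : Fin m → ℕ → A₃} {s u : K'State}
    (hu : ∀ w : List A₃, w.foldl step u = u)
    (h : ∀ i, (List.ofFn fun t : Fin l => W i t).foldl step s = s) {f : ℕ → A₃}
    (hf : (List.ofFn fun t : Fin l => f t).foldl step s = u) (i : Fin m) (r : A₃) :
    (List.ofFn (blockWord (l := l) (Function.update W i f) r)).foldl step s = u := by
  rw [ofFn_blockWord, List.foldl_append, foldl_flatten_eq_sink hu, hu]
  · refine List.forall_mem_ofFn_iff.2 fun j => ?_
    by_cases hj : j = i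
    · subst hj
      exact Or.inr (by simpa using hf)
    · exact Or.inl (by simpa [hj] using h j)
  · exact ⟨_, List.mem_ofFn.2 ⟨i, rfl⟩, by simpa using hf⟩

theorem foldl_denseBlock_ba {B y : ℕ} (hy : y < B) :
    (List.ofFn fun t : Fin (2 * B + 2) => denseBlock B 0 lb la (y + 1) t).foldl step zero =
      zero := by
  have := foldl_ofFn (n := 2 * B + 2)
    (fun t => if t = 0 then zero else if t ≤ y + 1 then one else if t ≤ B + 1 then zero
      else if t ≤ B + 2 + y then one else zero)
    (fun t => denseBlock B 0 lb la (y + 1) t) ?_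
  · refine Eq.trans ?_ (this.trans ?_) <;>
    split_ifs <;> first | rfl | omega
  · intro t
    simp only [denseBlock, sparseBlock]
    split_ifs <;> first | rfl | omega | contradiction

theorem foldl_sparseBlock_a {B : ℕ} :
    (List.ofFn fun t : Fin (2 * B + 2) => sparseBlock B 0 la t).foldl step zero = reject := by
  have := foldl_ofFn (n := 2 * B + 2)
    (fun t => if t = 0 then zero else if t ≤ B + 1 then one else reject)
    (fun t => sparseBlock B 0 la t) ?_
  · refine Eq.trans ?_ (this.trans ?_) <;>
    split_ifs <;> first | rfl | omega
  · intro t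
    simp only [sparseBlock]
    split_ifs <;> first | rfl | omega | contradiction

theorem foldl_denseBlock_ab {B y : ℕ} (hy : y < B) :
    (List.ofFn fun t : Fin (2 * B + 2) => denseBlock B B la lb y t).foldl step zero =
      zero := by
  have := foldl_ofFn (n := 2 * B + 2)
    (fun t => if t ≤ y then zero else if t ≤ B then one else if t ≤ B + 1 + y then zero
      else if t ≤ 2 * B + 1 then one else zero)
    (fun t => denseBlock B B la lb y t) ?_
  · refine Eq.trans ?_ (this.trans ?_) <;>
    split_ifs <;> first | rfl | omega
  · intro t
    simp only [denseBlock, sparseBlock]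
    split_ifs <;> first | rfl | omega

theorem foldl_sparseBlock_b {B : ℕ} :
    (List.ofFn fun t : Fin (2 * B + 2) => sparseBlock B B lb t).foldl step zero = accept := by
  have := foldl_ofFn (n := 2 * B + 2)
    (fun t => if t ≤ B then zero else if t ≤ 2 * B + 1 then minus else accept)
    (fun t => sparseBlock B B lb t) ?_
  · refine Eq.trans ?_ (this.trans ?_) <;>
    split_ifs <;> first | rfl | omega
  · intro t
    simp only [sparseBlock]
    split_ifs <;> first | rfl | omega

/-- Neither `K'` nor its complement is recognized by a Σ₂ circuit family. -/
theorem K'_not_recSigma2 :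
    ¬ RecSigma2 K'lang ∧ ¬ RecSigma2 ({w : List A₃ | w ∉ K'lang} : Language A₃) := by
  constructor
  · intro h
    obtain ⟨m, B, i, x, hx⟩ := h.exists_sparse 1 (fun _ => 0) lb la lb fun m B x =>
      mem_K'lang_iff_foldl.2 (foldl_blockWord_eq (fun i => foldl_denseBlock_ba (x i).2) lb)
    have hr := foldl_blockWord_update_eq foldl_reject
      (fun i => foldl_denseBlock_ba (x i).2) foldl_sparseBlock_a i lb
    exact absurd (hr.symm.trans (mem_K'lang_iff_foldl.1 hx)) nofun
  · intro h
    obtain ⟨m, B, i, x, hx⟩ := h.exists_sparse 0 (fun B => B) la lb lc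
      fun m B x hmem => absurd
        ((foldl_blockWord_eq (fun i => foldl_denseBlock_ab (x i).2) lc).symm.trans
          (mem_K'lang_iff_foldl.1 hmem)) nofun
    exact hx (mem_K'lang_iff_foldl.2 (foldl_blockWord_update_eq foldl_accept
      (fun i => foldl_denseBlock_ab (x i).2) foldl_sparseBlock_b i lc))
end

section
/- Neither the bounded-depth Dyck language D = D₁⁽²⁾ over A₃ nor its complement {w : List A₃ | w ∉ D} is recognized by a Σ₂ circuit family. (Hence D₁⁽²⁾ lies outside the class ÂC⁰₂ = Σ₂[arb] ∪ Π₂[arb] of depth-2 polynomial-size circuits with constant-arity input functions.) -/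
open RegularExpression in
/-- The regular expression for the bounded-depth Dyck language `D₁⁽²⁾ = (a·K·b + c)*`. -/
def Dexp : RegularExpression A₃ :=
  (char la * Kexp * char lb + char lc).star

/-- The language `D₁⁽²⁾`. -/
def Dlang : Language A₃ := Dexp.matches'

section Counting

variable {ι β : Type*} [DecidableEq ι] [DecidableEq β]

/-- If, on `G`, the coordinates in `Q` leave at most `k` options for the coordinate `i`, then
forgetting `i` shrinks the number of traces on any index set containing `Q` at most `k`-fold. -/
lemma card_image_restrict_insert_le {k : ℕ} {G : Finset (ι → β)} {i : ι} {Q S : Finset ι}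
    (hQS : Q ⊆ S)
    (h : ∀ x ∈ G, ∃ T : Finset β, T.card ≤ k ∧ ∀ v ∈ G, (∀ q ∈ Q, v q = x q) → v i ∈ T) :
    (G.image (insert i S).restrict).card ≤ k * (G.image S.restrict).card := by
  classical
  have hS : S ⊆ insert i S := Finset.subset_insert i S
  have himg : (G.image (insert i S).restrict).image (Finset.restrict₂ (π := fun _ => β) hS) =
      G.image S.restrict := by
    rw [Finset.image_image]
    rfl
  rw [← himg]
  refine Finset.card_le_mul_card_image _ _ fun a ha => ?_
  obtain ⟨x, hx, rfl⟩ : ∃ x ∈ G, S.restrict x = a := by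
    rw [himg] at ha
    simpa using ha
  obtain ⟨T, hT, hTG⟩ := h x hx
  refine (Finset.card_le_card_of_injOn (fun y => y ⟨i, Finset.mem_insert_self i S⟩) ?_ ?_).trans hT
  · intro y hy
    simp only [Finset.coe_filter, Finset.mem_image, Set.mem_ofPred_eq] at hy
    obtain ⟨⟨v, hv, rfl⟩, hvx⟩ := hy
    exact hTG v hv fun q hq => congrFun hvx ⟨q, hQS hq⟩
  · intro y hy z hz hyz
    simp only [Finset.coe_filter, Set.mem_ofPred_eq] at hy hz
    have hyz' := hy.2.trans hz.2.symm
    funext ⟨q, hq⟩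
    rcases Finset.mem_insert.1 hq with rfl | hqS
    · exact hyz
    · exact congrFun hyz' ⟨q, hqS⟩

variable [Fintype ι]

lemma exists_card_le_pow_mul_card_image_restrict {k : ℕ} {G : Finset (ι → β)}
    {Q : ι → Finset ι} (hQ : ∀ i, (Q i).card ≤ k) (hiQ : ∀ i, i ∉ Q i)
    (h : ∀ i, ∀ x ∈ G, ∃ T : Finset β, T.card ≤ k ∧
      ∀ v ∈ G, (∀ q ∈ Q i, v q = x q) → v i ∈ T) (e : ℕ) :
    ∀ R : Finset ι, R.card + e * (k + 1) ≤ Fintype.card ι →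
      ∃ I : Finset ι, Disjoint I R ∧ I.card = e ∧
        G.card ≤ k ^ e * (G.image (Iᶜ).restrict).card := by
  classical
  induction e with
  | zero =>
    refine fun R _ => ⟨∅, by simp, by simp, ?_⟩
    rw [pow_zero, one_mul, Finset.card_image_of_injective]
    intro x y hxy
    funext q
    exact congrFun hxy ⟨q, by simp⟩
  | succ e ih =>
    intro R hR
    rw [add_mul, one_mul] at hR
    obtain ⟨i, hi⟩ : ∃ i, i ∉ R := by
      by_contra! hall
      have hcard := Finset.card_eq_iff_eq_univ R |>.2 (Finset.eq_univ_iff_forall.2 hall)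
      omega
    have hR' : (insert i (R ∪ Q i)).card + e * (k + 1) ≤ Fintype.card ι := by
      have h₁ := Finset.card_insert_le i (R ∪ Q i)
      have h₂ := Finset.card_union_le R (Q i)
      have h₃ := hQ i
      omega
    obtain ⟨I, hI, hIe, hG⟩ := ih _ hR'
    rw [Finset.disjoint_insert_right, Finset.disjoint_union_right] at hI
    obtain ⟨hiI, hIR, hIQ⟩ := hI
    refine ⟨insert i I, Finset.disjoint_insert_left.2 ⟨hi, hIR⟩,
      by rw [Finset.card_insert_of_notMem hiI, hIe], hG.trans ?_⟩
    have hcompl : Iᶜ = insert i (insert i I)ᶜ := by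
      ext q
      by_cases hq : q = i <;> simp [hq, hiI]
    have hsub : Q i ⊆ (insert i I)ᶜ := by
      intro q hq
      simp only [Finset.mem_compl, Finset.mem_insert, not_or]
      exact ⟨fun hqi => hiQ i (hqi ▸ hq), Finset.disjoint_right.1 hIQ hq⟩
    rw [hcompl, pow_succ, mul_assoc]
    exact Nat.mul_le_mul_left _ (card_image_restrict_insert_le hsub (h i))

variable [Fintype β]

/-- A set of tuples in which every coordinate of every member is determined, up to `k` options, by
at most `k` other coordinates of that member, is small. -/
lemma card_le_of_forall_determined {k e : ℕ} (he : e * (k + 1) ≤ Fintype.card ι)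
    {F : Finset (ι → β)}
    (h : ∀ x ∈ F, ∀ i, ∃ (Q : Finset ι) (T : Finset β), Q.card ≤ k ∧ i ∉ Q ∧ T.card ≤ k ∧
      ∀ v ∈ F, (∀ q ∈ Q, v q = x q) → v i ∈ T) :
    F.card ≤ Fintype.card (ι → Finset ι) *
      (k ^ e * Fintype.card β ^ (Fintype.card ι - e)) := by
  classical
  let G : (ι → Finset ι) → Finset (ι → β) := fun Q => F.filter fun x =>
    ∀ i, (Q i).card ≤ k ∧ i ∉ Q i ∧ ∃ T : Finset β, T.card ≤ k ∧
      ∀ v ∈ F, (∀ q ∈ Q i, v q = x q) → v i ∈ T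
  have hcover : F ⊆ Finset.univ.biUnion G := by
    intro x hx
    choose Q T hQ hiQ hT hTF using h x hx
    simp only [Finset.mem_biUnion, Finset.mem_univ, true_and]
    exact ⟨Q, Finset.mem_filter.2 ⟨hx, fun i => ⟨hQ i, hiQ i, T i, hT i, hTF i⟩⟩⟩
  refine (Finset.card_le_card hcover).trans (Finset.card_biUnion_le_card_mul _ _ _ fun Q _ => ?_)
  obtain hempty | ⟨x₀, hx₀⟩ := (G Q).eq_empty_or_nonempty
  · simp [hempty]
  have hx₀' := (Finset.mem_filter.1 hx₀).2
  obtain ⟨I, -, hIe, hG⟩ := exists_card_le_pow_mul_card_image_restrict (G := G Q) (Q := Q)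
    (fun i => (hx₀' i).1) (fun i => (hx₀' i).2.1)
    (fun i x hx => by
      obtain ⟨T, hT, hTF⟩ := ((Finset.mem_filter.1 hx).2 i).2.2
      exact ⟨T, hT, fun v hv => hTF v (Finset.mem_filter.1 hv).1⟩) e ∅ (by simpa using he)
  refine hG.trans (Nat.mul_le_mul_left _ ((Finset.card_le_univ _).trans_eq ?_))
  rw [Fintype.card_fun, Fintype.card_coe, Finset.card_compl, hIe]

end Counting

section Families

variable {ι β A : Type*}

/-- A family of words of length `n`, indexed by tuples of optional values, each of whose letters
depends only on whether one particular coordinate takes one particular value. -/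
def PosLocal (n : ℕ) (f : (ι → Option β) → List A) : Prop :=
  (∀ y, (f y).length = n) ∧
    ∀ p : ℕ, ∃ (i : ι) (o : β), ∀ y z, (y i = some o ↔ z i = some o) → (f y)[p]? = (f z)[p]?

lemma PosLocal.const [Nonempty ι] [Nonempty β] (l : List A) :
    PosLocal l.length (fun _ : ι → Option β => l) :=
  ⟨fun _ => rfl, fun _ => ⟨Classical.arbitrary ι, Classical.arbitrary β, fun _ _ _ => rfl⟩⟩

lemma PosLocal.append {n m : ℕ} {f g : (ι → Option β) → List A} (hf : PosLocal n f)
    (hg : PosLocal m g) : PosLocal (n + m) (fun y => f y ++ g y) := by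
  refine ⟨fun y => by rw [List.length_append, hf.1, hg.1], fun p => ?_⟩
  rcases lt_or_ge p n with hp | hp
  · obtain ⟨i, o, h⟩ := hf.2 p
    refine ⟨i, o, fun y z hyz => ?_⟩
    rw [List.getElem?_append_left (by rwa [hf.1]), List.getElem?_append_left (by rwa [hf.1])]
    exact h y z hyz
  · obtain ⟨i, o, h⟩ := hg.2 (p - n)
    refine ⟨i, o, fun y z hyz => ?_⟩
    rw [List.getElem?_append_right (by rwa [hf.1]), List.getElem?_append_right (by rwa [hf.1]),
      hf.1, hf.1]
    exact h y z hyz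

lemma PosLocal.flatMap [Nonempty ι] [Nonempty β] {n : ℕ} {f : ι → (ι → Option β) → List A}
    (hf : ∀ i, PosLocal n (f i)) (l : List ι) :
    PosLocal (l.length * n) (fun y => l.flatMap fun i => f i y) := by
  induction l with
  | nil => simpa using PosLocal.const (ι := ι) (β := β) ([] : List A)
  | cons i l ih =>
    simp only [List.flatMap_cons, List.length_cons, add_mul, one_mul]
    rw [add_comm]
    exact (hf i).append ih

variable [Fintype ι] [DecidableEq ι] [Fintype β] [DecidableEq β]

/-- A Σ₂ circuit accepting all full words of a `PosLocal` family, but none of the words in which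
one coordinate has been left blank, has large size. -/
lemma Sigma2Circuit.card_le_of_posLocal {n s k e : ℕ} (he : e * (k + 1) ≤ Fintype.card ι)
    {C : (Fin n → A) → Prop} (hC : Sigma2Circuit s k C) {L : Language A}
    (hCL : ∀ w, C w ↔ List.ofFn w ∈ L) {f : (ι → Option β) → List A} (hf : PosLocal n f)
    (hfull : ∀ x : ι → β, f (fun i => some (x i)) ∈ L)
    (hblank : ∀ (x : ι → β) (i : ι), f (Function.update (fun i => some (x i)) i none) ∉ L) :
    Fintype.card (ι → β) ≤ s * (Fintype.card (ι → Finset ι) *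
      (k ^ e * Fintype.card β ^ (Fintype.card ι - e))) := by
  classical
  obtain ⟨s', hs', J, g, hg, hCg⟩ := hC
  choose b o hbo using hf.2
  let w : (ι → Option β) → Fin n → A := fun y p => (f y)[p]'(by rw [hf.1]; exact p.2)
  have hw : ∀ y, List.ofFn (w y) = f y := by
    intro y
    refine List.ext_getElem (by simp [hf.1]) fun p _ _ => ?_
    simp [w]
  have hwp : ∀ y z (p : Fin n), (y (b p) = some (o p) ↔ z (b p) = some (o p)) →
      w y p = w z p := by
    intro y z p hyz
    have := hbo p y z hyz
    rw [List.getElem?_eq_getElem (by rw [hf.1]; exact p.2),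
      List.getElem?_eq_getElem (by rw [hf.1]; exact p.2)] at this
    exact Option.some.inj this
  let F : Fin s' → Finset (ι → β) := fun t =>
    Finset.univ.filter fun x => ∀ j, g t j (w fun i => some (x i))
  have hcover : (Finset.univ : Finset (ι → β)) ⊆ Finset.univ.biUnion F := by
    intro x _
    obtain ⟨t, ht⟩ := (hCg _).1 ((hCL (w fun i => some (x i))).2 (by rw [hw]; exact hfull x))
    simp only [Finset.mem_biUnion, Finset.mem_univ, true_and]
    exact ⟨t, by simpa [F] using ht⟩
  have hF : ∀ t, (F t).card ≤ Fintype.card (ι → Finset ι) *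
      (k ^ e * Fintype.card β ^ (Fintype.card ι - e)) := by
    refine fun t => card_le_of_forall_determined he fun x hx i => ?_
    obtain ⟨j, hj⟩ : ∃ j, ¬ g t j (w (Function.update (fun i => some (x i)) i none)) := by
      by_contra! hall
      apply hblank x i
      rw [← hw]
      exact (hCL _).1 ((hCg _).2 ⟨t, hall⟩)
    obtain ⟨P, hPk, hP⟩ := hg t j
    refine ⟨(P.image fun p : Fin n => b p).erase i, P.image fun p : Fin n => o p,
      (Finset.card_erase_le.trans Finset.card_image_le).trans hPk, Finset.notMem_erase _ _,
      Finset.card_image_le.trans hPk, fun v hv hvx => ?_⟩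
    by_contra hvi
    refine hj ((hP _ _ fun p hp => hwp _ _ p ?_).2 ((Finset.mem_filter.1 hv).2 j))
    by_cases hpi : b p = i
    · have hne : v i ≠ o p := fun h => hvi (h ▸ Finset.mem_image_of_mem (fun p : Fin n => o p) hp)
      simp [hpi, hne]
    · have hq := hvx (b p)
        (Finset.mem_erase.2 ⟨hpi, Finset.mem_image_of_mem (fun p : Fin n => b p) hp⟩)
      simp [Function.update_of_ne hpi, hq]
  calc Fintype.card (ι → β) ≤ (Finset.univ.biUnion F).card := Finset.card_le_card hcover
    _ ≤ s' * _ := by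
      simpa using Finset.card_biUnion_le_card_mul Finset.univ F _ fun t _ => hF t
    _ ≤ _ := Nat.mul_le_mul_right _ hs'

end Families

lemma not_recSigma2_of_posLocal {A : Type*} {L : Language A}
    (h : ∀ (m : ℕ) [NeZero m], ∃ B : ℕ, ∀ (r : ℕ) [NeZero r], ∃ n ≤ B * r,
      ∃ f : (Fin m → Option (Fin r)) → List A, PosLocal n f ∧
        (∀ x : Fin m → Fin r, f (fun i => some (x i)) ∈ L) ∧
        ∀ (x : Fin m → Fin r) (i : Fin m),
          f (Function.update (fun i => some (x i)) i none) ∉ L) :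
    ¬ RecSigma2 L := by
  rintro ⟨k, c, d, hrec⟩
  let m := (d + 1) * (k + 1)
  have : NeZero m := ⟨by positivity⟩
  obtain ⟨B, hB⟩ := h m
  let N := Fintype.card (Fin m → Finset (Fin m))
  let r := c * (B + 1) ^ d * N * k ^ (d + 1) + 1
  obtain ⟨n, hn, f, hf, hfull, hblank⟩ := hB r
  obtain ⟨C, hC, hCL⟩ := hrec n
  have hcard := hC.card_le_of_posLocal (e := d + 1) (by simp [m]) hCL hf hfull hblank
  simp only [Fintype.card_fun, Fintype.card_fin] at hcard
  have hdm : d + 1 ≤ m := Nat.le_mul_of_pos_right _ (Nat.succ_pos k)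
  have hr : 0 < r := Nat.succ_pos _
  have hn' : n + 1 ≤ (B + 1) * r := by
    rw [add_mul, one_mul]
    exact Nat.add_le_add hn hr
  have hN : Fintype.card (Finset (Fin m)) ^ m = N := by simp [N]
  rw [hN] at hcard
  have hlt : c * (n + 1) ^ d * (N * (k ^ (d + 1) * r ^ (m - (d + 1)))) < r ^ m := by
    calc c * (n + 1) ^ d * (N * (k ^ (d + 1) * r ^ (m - (d + 1))))
        ≤ c * ((B + 1) * r) ^ d * (N * (k ^ (d + 1) * r ^ (m - (d + 1)))) := by gcongr
      _ = (c * (B + 1) ^ d * N * k ^ (d + 1)) * (r ^ d * r ^ (m - (d + 1))) := by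
        rw [mul_pow]
        ring
      _ < r * (r ^ d * r ^ (m - (d + 1))) :=
        Nat.mul_lt_mul_of_pos_right (Nat.lt_succ_self _) (by positivity)
      _ = r ^ m := by
        rw [← mul_assoc, ← pow_succ', ← pow_add, Nat.add_sub_cancel' hdm]
  exact absurd hcard (not_le.2 hlt)

section Dyck

/-- The height change caused by a word: the number of `a`s minus the number of `b`s. -/
def height (w : List A₃) : ℤ := (w.map ![1, -1, 0]).sum

@[simp] lemma height_nil : height [] = 0 := rfl

@[simp] lemma height_append (u v : List A₃) : height (u ++ v) = height u + height v := by
  simp [height]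

@[simp] lemma height_la_cons (w : List A₃) : height (la :: w) = 1 + height w := by
  simp [height, la]

@[simp] lemma height_lb_cons (w : List A₃) : height (lb :: w) = -1 + height w := by
  simp [height, lb]

@[simp] lemma height_lc_cons (w : List A₃) : height (lc :: w) = height w := by
  simp [height, lc]

/-- Words of total height change `0` whose prefixes all have height at most `h`. -/
def heightLE (h : ℤ) : Language A₃ := {w | height w = 0 ∧ ∀ u, u <+: w → height u ≤ h}

lemma nil_mem_heightLE {h : ℤ} (hh : 0 ≤ h) : [] ∈ heightLE h :=
  ⟨rfl, fun u hu => by rw [List.prefix_nil.1 hu]; exact hh⟩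

lemma prefix_or_exists_of_prefix_append {A : Type*} {u v w : List A} (h : u <+: v ++ w) :
    u <+: v ∨ ∃ t, u = v ++ t ∧ t <+: w := by
  rcases List.prefix_or_prefix_of_prefix h (List.prefix_append v w) with huv | ⟨t, rfl⟩
  · exact Or.inl huv
  · exact Or.inr ⟨t, rfl, (List.prefix_append_right_inj v).1 h⟩

lemma append_mem_heightLE {h : ℤ} {v w : List A₃} (hv : v ∈ heightLE h) (hw : w ∈ heightLE h) :
    v ++ w ∈ heightLE h := by
  refine ⟨by rw [height_append, hv.1, hw.1, add_zero], fun u hu => ?_⟩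
  rcases prefix_or_exists_of_prefix_append hu with hu | ⟨t, rfl, ht⟩
  · exact hv.2 u hu
  · rw [height_append, hv.1, zero_add]
    exact hw.2 t ht

lemma kstar_le_heightLE {h : ℤ} (hh : 0 ≤ h) {L : Language A₃} (hL : L ≤ heightLE h) :
    KStar.kstar L ≤ heightLE h := by
  intro w hw
  obtain ⟨S, rfl, hS⟩ := Language.mem_kstar.1 hw
  induction S with
  | nil => exact nil_mem_heightLE hh
  | cons v S ih =>
    rw [List.flatten_cons]
    have hS' : ∀ y ∈ S, y ∈ L := fun y hy => hS y (List.mem_cons_of_mem _ hy)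
    exact append_mem_heightLE (hL (hS v List.mem_cons_self))
      (ih hS' (Language.mem_kstar.2 ⟨S, rfl, hS'⟩))

lemma bracket_mem_heightLE {h : ℤ} (hh : 0 ≤ h) {w : List A₃} (hw : w ∈ heightLE h) :
    [la] ++ w ++ [lb] ∈ heightLE (h + 1) := by
  refine ⟨by simp [hw.1], fun u hu => ?_⟩
  rcases u with _ | ⟨x, u⟩
  · rw [height_nil]; omega
  · simp only [List.cons_append, List.nil_append, List.cons_prefix_cons] at hu
    obtain ⟨rfl, hu⟩ := hu
    rw [height_la_cons, add_comm]
    rcases prefix_or_exists_of_prefix_append hu with hu | ⟨t, rfl, ht⟩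
    · exact add_le_add_left (hw.2 u hu) 1
    · rw [height_append, hw.1]
      rcases t with _ | ⟨y, t⟩
      · rw [height_nil]; omega
      · obtain ⟨rfl, ht'⟩ := List.cons_prefix_cons.1 ht
        rw [List.prefix_nil.1 ht', height_lb_cons, height_nil]
        omega

lemma singleton_lc_mem_heightLE {h : ℤ} (hh : 0 ≤ h) : [lc] ∈ heightLE h := by
  refine ⟨by simp, fun u hu => ?_⟩
  rcases u with _ | ⟨x, u⟩
  · exact hh
  · obtain ⟨rfl, hu'⟩ := List.cons_prefix_cons.1 hu
    rw [List.prefix_nil.1 hu', height_lc_cons, height_nil]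
    exact hh

lemma bracket_add_lc_le_heightLE {h : ℤ} (hh : 0 ≤ h) {L : Language A₃} (hL : L ≤ heightLE h) :
    ({[la]} * L * {[lb]} + {[lc]} : Language A₃) ≤ heightLE (h + 1) := by
  rintro w (hw | hw)
  · obtain ⟨_, ⟨_, rfl, v, hv, rfl⟩, _, rfl, rfl⟩ := hw
    exact bracket_mem_heightLE hh (hL hv)
  · rw [hw]
    exact singleton_lc_mem_heightLE (by omega)

lemma Dlang_le_heightLE : Dlang ≤ heightLE 2 := by
  have hc : KStar.kstar ({[lc]} : Language A₃) ≤ heightLE 0 :=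
    kstar_le_heightLE le_rfl fun w hw => by
      rw [hw]
      exact singleton_lc_mem_heightLE le_rfl
  have hK : KStar.kstar ({[la]} * KStar.kstar {[lc]} * {[lb]} + {[lc]} : Language A₃) ≤
      heightLE 1 :=
    kstar_le_heightLE zero_le_one (bracket_add_lc_le_heightLE le_rfl hc)
  exact kstar_le_heightLE zero_le_two (bracket_add_lc_le_heightLE zero_le_one hK)

lemma append_mem_kstar {A : Type*} {L : Language A} {u v : List A} (hu : u ∈ KStar.kstar L)
    (hv : v ∈ KStar.kstar L) : u ++ v ∈ KStar.kstar L := by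
  obtain ⟨S, rfl, hS⟩ := Language.mem_kstar.1 hu
  obtain ⟨T, rfl, hT⟩ := Language.mem_kstar.1 hv
  refine Language.mem_kstar.2 ⟨S ++ T, by simp, fun y hy => ?_⟩
  rcases List.mem_append.1 hy with hy | hy
  · exact hS y hy
  · exact hT y hy

lemma mem_kstar_of_mem {A : Type*} {L : Language A} {u : List A} (hu : u ∈ L) :
    u ∈ KStar.kstar L :=
  Language.mem_kstar.2 ⟨[u], by simp, by simpa using hu⟩

lemma flatMap_mem_kstar {A γ : Type*} {L : Language A} {l : List γ} {f : γ → List A}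
    (h : ∀ i ∈ l, f i ∈ KStar.kstar L) : l.flatMap f ∈ KStar.kstar L := by
  induction l with
  | nil => exact Language.nil_mem_kstar L
  | cons i l ih =>
    rw [List.flatMap_cons]
    exact append_mem_kstar (h i List.mem_cons_self)
      (ih fun j hj => h j (List.mem_cons_of_mem _ hj))

lemma replicate_mem_kstar {A : Type*} {L : Language A} {x : A} (hx : [x] ∈ L) (n : ℕ) :
    List.replicate n x ∈ KStar.kstar L :=
  Language.mem_kstar.2 ⟨List.replicate n [x], by simp, fun y hy => by
    rwa [List.eq_of_mem_replicate hy]⟩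

lemma append_mem_Klang_s16 {u v : List A₃} (hu : u ∈ Klang) (hv : v ∈ Klang) : u ++ v ∈ Klang :=
  append_mem_kstar hu hv

lemma append_mem_Dlang {u v : List A₃} (hu : u ∈ Dlang) (hv : v ∈ Dlang) : u ++ v ∈ Dlang :=
  append_mem_kstar hu hv

lemma replicate_lc_mem_Klang (n : ℕ) : List.replicate n lc ∈ Klang :=
  replicate_mem_kstar (Or.inr rfl) n

lemma bracket_replicate_mem_Klang (n : ℕ) : [la] ++ List.replicate n lc ++ [lb] ∈ Klang :=
  mem_kstar_of_mem (Or.inl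
    ⟨_, ⟨_, rfl, _, replicate_mem_kstar (L := {[lc]}) rfl n, rfl⟩, _, rfl, rfl⟩)

lemma bracket_mem_Dlang {w : List A₃} (hw : w ∈ Klang) : [la] ++ w ++ [lb] ∈ Dlang :=
  mem_kstar_of_mem (Or.inl ⟨_, ⟨_, rfl, _, hw, rfl⟩, _, rfl, rfl⟩)

lemma Klang_le_Dlang : Klang ≤ Dlang := by
  intro w hw
  obtain ⟨S, rfl, hS⟩ := Language.mem_kstar.1 hw
  refine Language.mem_kstar.2 ⟨S, rfl, fun y hy => ?_⟩
  rcases hS y hy with hy | hy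
  · obtain ⟨_, ⟨_, rfl, v, hv, rfl⟩, _, rfl, rfl⟩ := hy
    refine Or.inl ⟨_, ⟨_, rfl, v, ?_, rfl⟩, _, rfl, rfl⟩
    obtain ⟨T, rfl, hT⟩ := Language.mem_kstar.1 hv
    exact Language.mem_kstar.2 ⟨T, rfl, fun z hz => Or.inr (hT z hz)⟩
  · exact Or.inr hy

end Dyck

section Windows

variable {m r : ℕ}

/-- A window of length `r` carrying the letter `x` at position `t`, if any, and `c` elsewhere. -/
def window (x : A₃) (t : Option (Fin r)) : List A₃ :=
  (List.finRange r).map fun o => if t = some o then x else lc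

lemma window_none (x : A₃) : window x (none : Option (Fin r)) = List.replicate r lc := by
  simp [window]

lemma exists_window_some_eq (x : A₃) (o : Fin r) :
    ∃ p q, window x (some o) = List.replicate p lc ++ [x] ++ List.replicate q lc := by
  obtain ⟨s, t, hst⟩ := List.append_of_mem (List.mem_finRange o)
  have hnd := List.nodup_finRange r
  rw [hst, List.nodup_append, List.nodup_cons] at hnd
  have hc : ∀ l : List (Fin r), o ∉ l →
      l.map (fun o' => if some o = some o' then x else lc) = List.replicate l.length lc := by
    intro l hl
    refine List.eq_replicate_iff.2 ⟨List.length_map _, fun y hy => ?_⟩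
    obtain ⟨o', ho', rfl⟩ := List.mem_map.1 hy
    have hne : o ≠ o' := fun h => hl (h ▸ ho')
    simp [hne]
  refine ⟨s.length, t.length, ?_⟩
  rw [window, hst, List.map_append, List.map_cons,
    hc s fun h => hnd.2.2 o h o List.mem_cons_self rfl, hc t hnd.2.1.1]
  simp

lemma posLocal_window [NeZero r] (x : A₃) (i : Fin m) :
    PosLocal r (fun y : Fin m → Option (Fin r) => window x (y i)) := by
  refine ⟨fun y => by simp [window], fun p => ?_⟩
  by_cases hp : p < r
  · refine ⟨i, ⟨p, hp⟩, fun y z hyz => ?_⟩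
    simp [window, hp, hyz]
  · refine ⟨i, 0, fun y z _ => ?_⟩
    rw [List.getElem?_eq_none (by simpa [window] using hp),
      List.getElem?_eq_none (by simpa [window] using hp)]

/-- The block `a W`, where the window `W` carries a `b`. -/
def openBlock (t : Option (Fin r)) : List A₃ := [la] ++ window lb t

/-- The block `W b`, where the window `W` carries an `a`. -/
def closeBlock (t : Option (Fin r)) : List A₃ := window la t ++ [lb]

lemma openBlock_some_mem_Klang (o : Fin r) : openBlock (some o) ∈ Klang := by
  obtain ⟨p, q, h⟩ := exists_window_some_eq lb o
  rw [openBlock, h, ← List.append_assoc, ← List.append_assoc]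
  exact append_mem_Klang_s16 (bracket_replicate_mem_Klang p) (replicate_lc_mem_Klang q)

lemma closeBlock_some_mem_Klang (o : Fin r) : closeBlock (some o) ∈ Klang := by
  obtain ⟨p, q, h⟩ := exists_window_some_eq la o
  rw [closeBlock, h, List.append_assoc, List.append_assoc, ← List.append_assoc [la]]
  exact append_mem_Klang_s16 (replicate_lc_mem_Klang p) (bracket_replicate_mem_Klang q)

lemma openBlock_none : openBlock (none : Option (Fin r)) = [la] ++ List.replicate r lc := by
  rw [openBlock, window_none]

lemma closeBlock_none : closeBlock (none : Option (Fin r)) = List.replicate r lc ++ [lb] := by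
  rw [closeBlock, window_none]

lemma posLocal_openBlock [NeZero m] [NeZero r] (i : Fin m) :
    PosLocal (1 + r) (fun y : Fin m → Option (Fin r) => openBlock (y i)) :=
  (PosLocal.const [la]).append (posLocal_window lb i)

lemma posLocal_closeBlock [NeZero m] [NeZero r] (i : Fin m) :
    PosLocal (r + 1) (fun y : Fin m → Option (Fin r) => closeBlock (y i)) :=
  (posLocal_window la i).append (PosLocal.const [lb])

lemma flatMap_mem_Klang {f : Option (Fin r) → List A₃} (hf : ∀ o, f (some o) ∈ Klang)
    (x : Fin m → Fin r) (l : List (Fin m)) : (l.flatMap fun i => f (some (x i))) ∈ Klang :=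
  flatMap_mem_kstar fun _ _ => hf _

/-- Blanking one coordinate splits a product of `K`-blocks around the blank block. -/
lemma exists_flatMap_update_none {f : Option (Fin r) → List A₃} (hf : ∀ o, f (some o) ∈ Klang)
    (x : Fin m → Fin r) (i : Fin m) :
    ∃ u ∈ Klang, ∃ v ∈ Klang,
      ((List.finRange m).flatMap fun j => f (Function.update (fun j => some (x j)) i none j)) =
        u ++ f none ++ v := by
  obtain ⟨s, t, hst⟩ := List.append_of_mem (List.mem_finRange i)
  have hnd := List.nodup_finRange m
  rw [hst, List.nodup_append, List.nodup_cons] at hnd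
  have hl : ∀ l : List (Fin m), i ∉ l →
      (l.flatMap fun j => f (Function.update (fun j => some (x j)) i none j)) =
        l.flatMap fun j => f (some (x j)) := by
    intro l hl
    refine List.flatMap_congr fun j hj => ?_
    have hne : j ≠ i := fun h => hl (h ▸ hj)
    rw [Function.update_of_ne hne]
  refine ⟨_, flatMap_mem_Klang hf x s, _, flatMap_mem_Klang hf x t, ?_⟩
  rw [hst, List.flatMap_append, List.flatMap_cons,
    hl s fun h => hnd.2.2 i h i List.mem_cons_self rfl, hl t hnd.2.1.1, Function.update_self,
    List.append_assoc]

lemma height_eq_zero_of_mem_Klang {w : List A₃} (hw : w ∈ Klang) : height w = 0 :=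
  (Dlang_le_heightLE (Klang_le_Dlang hw)).1

lemma height_replicate_lc (n : ℕ) : height (List.replicate n lc) = 0 :=
  height_eq_zero_of_mem_Klang (replicate_lc_mem_Klang n)

/-- A product of open blocks, which is balanced as long as no window is blank. -/
def openWord (y : Fin m → Option (Fin r)) : List A₃ :=
  (List.finRange m).flatMap fun i => openBlock (y i)

/-- A product of close blocks, which is balanced as long as no window is blank. -/
def closeWord (y : Fin m → Option (Fin r)) : List A₃ :=
  (List.finRange m).flatMap fun i => closeBlock (y i)

lemma posLocal_openWord [NeZero m] [NeZero r] :
    PosLocal (m * (1 + r)) (openWord : (Fin m → Option (Fin r)) → List A₃) := by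
  have h := PosLocal.flatMap (posLocal_openBlock (m := m) (r := r)) (List.finRange m)
  rwa [List.length_finRange] at h

lemma posLocal_closeWord [NeZero m] [NeZero r] :
    PosLocal (m * (r + 1)) (closeWord : (Fin m → Option (Fin r)) → List A₃) := by
  have h := PosLocal.flatMap (posLocal_closeBlock (m := m) (r := r)) (List.finRange m)
  rwa [List.length_finRange] at h

/-- A word which rises to height `3` between its two block products when no window is blank. -/
def peakWord (y : Fin m → Option (Fin r)) : List A₃ :=
  [la] ++ closeWord y ++ [la, la, lb, lb] ++ openWord y ++ [lb]

lemma posLocal_peakWord [NeZero m] [NeZero r] :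
    PosLocal (1 + m * (r + 1) + 4 + m * (1 + r) + 1)
      (peakWord : (Fin m → Option (Fin r)) → List A₃) :=
  ((((PosLocal.const [la]).append posLocal_closeWord).append
    (PosLocal.const [la, la, lb, lb])).append posLocal_openWord).append (PosLocal.const [lb])

lemma peakWord_some_notMem_Dlang (x : Fin m → Fin r) :
    peakWord (fun i => some (x i)) ∉ Dlang := by
  intro hmem
  have hle := (Dlang_le_heightLE hmem).2
    ([la] ++ closeWord (fun i => some (x i)) ++ [la, la])
    ⟨[lb, lb] ++ openWord (fun i => some (x i)) ++ [lb], by simp [peakWord]⟩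
  have h₀ : height (closeWord fun i => some (x i)) = 0 :=
    height_eq_zero_of_mem_Klang (flatMap_mem_Klang closeBlock_some_mem_Klang x _)
  simp [h₀] at hle

lemma peakWord_update_none_mem_Dlang (x : Fin m → Fin r) (i : Fin m) :
    peakWord (Function.update (fun i => some (x i)) i none) ∈ Dlang := by
  obtain ⟨u, hu, v, hv, huv⟩ := exists_flatMap_update_none closeBlock_some_mem_Klang x i
  obtain ⟨u', hu', v', hv', huv'⟩ := exists_flatMap_update_none openBlock_some_mem_Klang x i
  have heq : peakWord (Function.update (fun i => some (x i)) i none) =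
      ([la] ++ (u ++ List.replicate r lc) ++ [lb]) ++ v ++
        ([la] ++ ([la] ++ List.replicate 0 lc ++ [lb]) ++ [lb]) ++ u' ++
        ([la] ++ (List.replicate r lc ++ v') ++ [lb]) := by
    rw [peakWord, closeWord, openWord, huv, huv', closeBlock_none, openBlock_none]
    simp
  rw [heq]
  have hr := replicate_lc_mem_Klang r
  exact append_mem_Dlang (append_mem_Dlang (append_mem_Dlang (append_mem_Dlang
    (bracket_mem_Dlang (append_mem_Klang_s16 hu hr)) (Klang_le_Dlang hv))
    (bracket_mem_Dlang (bracket_replicate_mem_Klang 0))) (Klang_le_Dlang hu'))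
    (bracket_mem_Dlang (append_mem_Klang_s16 hr hv'))

lemma openWord_update_none_notMem_Dlang (x : Fin m → Fin r) (i : Fin m) :
    openWord (Function.update (fun i => some (x i)) i none) ∉ Dlang := by
  intro hmem
  obtain ⟨u, hu, v, hv, huv⟩ := exists_flatMap_update_none openBlock_some_mem_Klang x i
  have h₀ := (Dlang_le_heightLE hmem).1
  rw [openWord, huv, openBlock_none] at h₀
  simp [height_eq_zero_of_mem_Klang hu, height_eq_zero_of_mem_Klang hv,
    height_replicate_lc] at h₀

end Windows

/-- Neither `D₁⁽²⁾` nor its complement is recognized by a Σ₂ circuit family. -/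
theorem D_not_recSigma2 :
    ¬ RecSigma2 Dlang ∧ ¬ RecSigma2 ({w : List A₃ | w ∉ Dlang} : Language A₃) := by
  constructor
  · refine not_recSigma2_of_posLocal fun m _ => ⟨m * 2, fun r _ => ⟨_, ?_, openWord,
      posLocal_openWord,
      fun x => Klang_le_Dlang (flatMap_mem_Klang openBlock_some_mem_Klang x _),
      openWord_update_none_notMem_Dlang⟩⟩
    have hr : 1 ≤ r := NeZero.one_le
    nlinarith
  · refine not_recSigma2_of_posLocal fun m _ => ⟨4 * m + 6, fun r _ => ⟨_, ?_, peakWord,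
      posLocal_peakWord, peakWord_some_notMem_Dlang,
      fun x i h => h (peakWord_update_none_mem_Dlang x i)⟩⟩
    have hr : 1 ≤ r := NeZero.one_le
    nlinarith
end

section
/- The class of languages recognized by Σ₂ circuit families is closed under quotients: if a language L over an alphabet A is recognized by a Σ₂ circuit family and x ∈ A, then the left quotient x⁻¹L = {w : List A | x :: w ∈ L} and the right quotient Lx⁻¹ = {w : List A | w ++ [x] ∈ L} are both recognized by Σ₂ circuit families. -/
/-- Locality is preserved by substitutions in which every output letter depends on at most one
input letter. -/
theorem KLocal.comp {ι κ A : Type*} {k : ℕ} {g : (κ → A) → Prop} (hg : KLocal k g)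
    {f : (ι → A) → κ → A} {e : κ → Finset ι} (he : ∀ p, (e p).card ≤ 1)
    (hf : ∀ p w v, (∀ q ∈ e p, w q = v q) → f w p = f v p) :
    KLocal k (fun w => g (f w)) := by
  classical
  obtain ⟨P, hP, h⟩ := hg
  refine ⟨P.biUnion e, ?_, fun w v hwv => h _ _ fun p hp => hf p w v fun q hq => ?_⟩
  · have := Finset.card_biUnion_le_card_mul P e 1 fun p _ => he p
    omega
  · exact hwv q (Finset.mem_biUnion.2 ⟨p, hp, hq⟩)

/-- Σ₂-circuits can be precomposed with substitutions in which every output letter depends on at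
most one input letter. -/
theorem Sigma2Circuit.comp {ι κ A : Type*} {s k : ℕ} {C : (κ → A) → Prop}
    (hC : Sigma2Circuit s k C) {f : (ι → A) → κ → A} {e : κ → Finset ι}
    (he : ∀ p, (e p).card ≤ 1) (hf : ∀ p w v, (∀ q ∈ e p, w q = v q) → f w p = f v p) :
    Sigma2Circuit s k (fun w => C (f w)) := by
  obtain ⟨s', hs, J, g, hg, h⟩ := hC
  exact ⟨s', hs, J, fun i j w => g i j (f w), fun i j => (hg i j).comp he hf, fun w => h (f w)⟩

theorem Sigma2Circuit.mono {ι A : Type*} {s t k : ℕ} {C : (ι → A) → Prop}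
    (hC : Sigma2Circuit s k C) (hst : s ≤ t) : Sigma2Circuit t k C := by
  obtain ⟨s', hs, h⟩ := hC
  exact ⟨s', hs.trans hst, h⟩

/-- Recognition by Σ₂ circuit families pulls back along substitutions that lengthen words by one
letter and in which every output letter depends on at most one input letter. -/
theorem RecSigma2.preimage_succ {A : Type*} {L M : Language A} (h : RecSigma2 L)
    (f : ∀ n : ℕ, (Fin n → A) → Fin (n + 1) → A) (e : ∀ n : ℕ, Fin (n + 1) → Finset (Fin n))
    (he : ∀ n p, (e n p).card ≤ 1)
    (hf : ∀ n p w v, (∀ q ∈ e n p, w q = v q) → f n w p = f n v p)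
    (hM : ∀ n (w : Fin n → A), List.ofFn (f n w) ∈ L ↔ List.ofFn w ∈ M) :
    RecSigma2 M := by
  obtain ⟨k, c, d, h⟩ := h
  refine ⟨k, c * 2 ^ d, d, fun n => ?_⟩
  obtain ⟨C, hC, hL⟩ := h (n + 1)
  refine ⟨fun w => C (f n w), (hC.comp (he n) (hf n)).mono ?_, fun w => (hL _).trans (hM n w)⟩
  rw [mul_assoc, ← mul_pow]
  gcongr
  omega

/-- Closure of Σ₂ circuit families under left and right quotients by a letter. -/
theorem recSigma2_quotient {A : Type*} (L : Language A) (h : RecSigma2 L) (x : A) :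
    RecSigma2 ({w : List A | x :: w ∈ L} : Language A) ∧
    RecSigma2 ({w : List A | w ++ [x] ∈ L} : Language A) := by
  constructor
  · refine h.preimage_succ (fun n w => Fin.cons x w)
      (fun n => Fin.cons ∅ fun i => {i}) (fun n p => ?_) (fun n p w v => ?_) (fun n w => ?_)
    · cases p using Fin.cases <;> simp
    · cases p using Fin.cases <;> simp
    · rw [List.ofFn_cons]
      rfl
  · refine h.preimage_succ (fun n w => Fin.snoc (α := fun _ => A) w x)
      (fun n => Fin.snoc (α := fun _ => Finset (Fin n)) (fun i => {i}) ∅)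
      (fun n p => ?_) (fun n p w v => ?_) (fun n w => ?_)
    · cases p using Fin.lastCases <;> simp
    · cases p using Fin.lastCases <;> simp
    · rw [List.ofFn_succ']
      simp only [Fin.snoc_castSucc, Fin.snoc_last, List.concat_eq_append]
      rfl
end

section
/- The class of languages recognized by Σ₂ circuit families is closed under inverse length-multiplying morphisms: let A, B be alphabets, r : ℕ, and h₀ : A → List B a map with (h₀ x).length = r for every x ∈ A; let h : List A → List B be the induced monoid morphism h w = (w.map h₀).flatten. If a language L over B is recognized by a Σ₂ circuit family, then the language h⁻¹(L) = {w : List A | h w ∈ L} over A is recognized by a Σ₂ circuit family. -/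
/-- Locality is preserved by substitutions in which every letter of the image depends on a
single letter of the source. -/
theorem KLocal.comp_substitution {ι κ A B : Type*} {k : ℕ} {g : (κ → B) → Prop}
    (hg : KLocal k g) (σ : κ → ι) (f : κ → A → B) :
    KLocal k fun w : ι → A => g fun p => f p (w (σ p)) := by
  classical
  obtain ⟨P, hP, hloc⟩ := hg
  refine ⟨P.image σ, Finset.card_image_le.trans hP, fun w v hwv => hloc _ _ fun p hp => ?_⟩
  simp only [hwv (σ p) (Finset.mem_image_of_mem σ hp)]

/-- Σ₂-circuits are preserved by substitutions in which every letter of the image depends on a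
single letter of the source. -/
theorem Sigma2Circuit.comp_substitution {ι κ A B : Type*} {s k : ℕ} {C : (κ → B) → Prop}
    (hC : Sigma2Circuit s k C) (σ : κ → ι) (f : κ → A → B) :
    Sigma2Circuit s k fun w : ι → A => C fun p => f p (w (σ p)) := by
  obtain ⟨s', hs, J, g, hg, hC⟩ := hC
  exact ⟨s', hs, J, fun i j w => g i j fun p => f p (w (σ p)),
    fun i j => (hg i j).comp_substitution σ f, fun w => hC _⟩

theorem List.ofFn_substitution {A B : Type*} {n r : ℕ} (h₀ : A → List B)
    (hlen : ∀ x : A, (h₀ x).length = r) (w : Fin n → A) :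
    List.ofFn (fun p : Fin (n * r) =>
        (h₀ (w p.divNat)).get (p.modNat.cast (hlen (w p.divNat)).symm)) =
      ((List.ofFn w).map h₀).flatten := by
  have key (i : Fin n) : List.ofFn (fun j : Fin r => (h₀ (w i)).get (j.cast (hlen (w i)).symm)) =
      h₀ (w i) := by
    apply List.ext_get <;> simp [hlen]
  rw [List.ofFn_mul, List.map_ofFn]
  congr 2
  funext i
  rw [Function.comp_apply, ← key i]
  congr 1
  funext j
  have hr : 0 < r := j.pos
  have hdiv : (i * r + j : ℕ) / r = i := by
    rw [Nat.mul_comm, Nat.mul_add_div hr, Nat.div_eq_of_lt j.isLt, Nat.add_zero]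
  have hmod : (i * r + j : ℕ) % r = j := by
    rw [Nat.mul_comm, Nat.mul_add_mod, Nat.mod_eq_of_lt j.isLt]
  have letter (q : Fin n) (m : Fin r) (hq : q = i) (hm : m = j) :
      (h₀ (w q)).get (m.cast (hlen (w q)).symm) = (h₀ (w i)).get (j.cast (hlen (w i)).symm) := by
    subst hq hm
    rfl
  exact letter _ _ (Fin.ext hdiv) (Fin.ext hmod)

/-- Closure of Σ₂ circuit families under inverse length-multiplying morphisms. -/
theorem recSigma2_inv_lm_morphism {A B : Type*} (r : ℕ) (h₀ : A → List B)
    (hlen : ∀ x : A, (h₀ x).length = r) (L : Language B) (h : RecSigma2 L) :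
    RecSigma2 ({w : List A | (w.map h₀).flatten ∈ L} : Language A) := by
  obtain ⟨k, c, d, hL⟩ := h
  refine ⟨k, c * (r + 1) ^ d, d, fun n => ?_⟩
  obtain ⟨C, hC, hCL⟩ := hL (n * r)
  have hsize : c * (n * r + 1) ^ d ≤ c * (r + 1) ^ d * (n + 1) ^ d := by
    rw [Nat.mul_assoc, ← Nat.mul_pow]
    gcongr
    nlinarith
  refine ⟨_, (hC.comp_substitution Fin.divNat
    fun p x => (h₀ x).get (p.modNat.cast (hlen x).symm)).mono hsize, fun w => ?_⟩
  rw [hCL, List.ofFn_substitution h₀ hlen w]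
  rfl
end

section
/- Let M be a monoid, x, y ∈ M with x·x = x, let t ≥ 1, and let x₁, …, x_t, y₁, …, y_t ∈ M be such that the product x₁·y₁·⋯·x_t·y_t equals x and y₁·⋯·y_t equals y. Fix m ≥ 1 and, for i ∈ {1, …, m}, let X_i : List M be the concatenation over j = 1, …, t of the lists (List.replicate (i-1) 1) ++ [x_j] ++ (List.replicate (m-i) 1) ++ [y_j], and let Y : List M be the concatenation over j = 1, …, t of (List.replicate m 1) ++ [y_j]. Then: (i) X_i.prod = x for every i, and Y.prod = y; (ii) every T-good word, i.e., every concatenation X_{i₁} ++ X_{i₂} ++ ⋯ ++ X_{i_r} of at least one of the words X_i, has product x; (iii) every T-bad word, i.e., every concatenation of the form (X_{i₁} ++ ⋯ ++ X_{i_r}) ++ Y ++ (X_{j₁} ++ ⋯ ++ X_{j_s}) with r ≥ 1 and s ≥ 1, has product x·y·x. -/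
/-- A nonempty concatenation of words that all evaluate to an idempotent `x` evaluates to `x`. -/
theorem List.prod_flatten_map_of_idempotent {ι M : Type*} [Monoid M] {x : M} (hx : x * x = x)
    {X : ι → List M} (hX : ∀ i, (X i).prod = x) {I : List ι} (hI : I ≠ []) :
    ((I.map X).flatten).prod = x := by
  have hmap : I.map (List.prod ∘ X) = List.replicate I.length x :=
    List.eq_replicate_iff.2 ⟨by simp, by simp [hX]⟩
  have hlen : I.length ≠ 0 := by simpa using hI
  rw [List.prod_flatten, List.map_map, hmap, List.prod_replicate]
  exact IsIdempotentElem.pow_eq hx hlen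

/-- Products of the building blocks of `T`-good and `T`-bad words: the words
`X i = ∏ⱼ (1^(i-1)·xⱼ·1^(m-i)·yⱼ)` evaluate to `x`, `Y = ∏ⱼ (1^m·yⱼ)` evaluates
to `y`, any nonempty concatenation of `X i`'s (a `T`-good word) evaluates to `x`,
and any such concatenation with one `Y` inserted strictly inside (a `T`-bad word)
evaluates to `x·y·x`. -/
theorem tgood_tbad_products {M : Type*} [Monoid M] (x y : M) (hx : x * x = x)
    (t : ℕ) (ht : 1 ≤ t) (xs ys : Fin t → M)
    (hxprod : ((List.ofFn fun j : Fin t => [xs j, ys j]).flatten).prod = x)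
    (hyprod : (List.ofFn ys).prod = y)
    (m : ℕ) (hm : 1 ≤ m) :
    let X : ℕ → List M := fun i =>
      (List.ofFn fun j : Fin t =>
        List.replicate (i - 1) (1 : M) ++ [xs j] ++
          List.replicate (m - i) (1 : M) ++ [ys j]).flatten
    let Y : List M :=
      (List.ofFn fun j : Fin t => List.replicate m (1 : M) ++ [ys j]).flatten
    ((∀ i : ℕ, 1 ≤ i → i ≤ m → (X i).prod = x) ∧
     Y.prod = y ∧
     (∀ I : List ℕ, I ≠ [] → (∀ i ∈ I, 1 ≤ i ∧ i ≤ m) →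
       ((I.map X).flatten).prod = x) ∧
     (∀ I J : List ℕ, I ≠ [] → J ≠ [] →
       (∀ i ∈ I, 1 ≤ i ∧ i ≤ m) → (∀ i ∈ J, 1 ≤ i ∧ i ≤ m) →
       ((I.map X).flatten ++ Y ++ (J.map X).flatten).prod = x * y * x)) := by
  intro X Y
  have hX : ∀ i, (X i).prod = x := fun i => by
    rw [← hxprod]
    simp [X, List.prod_flatten, List.map_ofFn, Function.comp_def]
  have hY : Y.prod = y := by
    rw [← hyprod]
    simp [Y, List.prod_flatten, List.map_ofFn, Function.comp_def]
  refine ⟨fun i _ _ => hX i, hY, fun I hI _ => List.prod_flatten_map_of_idempotent hx hX hI,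
    fun I J hI hJ _ _ => ?_⟩
  rw [List.prod_append, List.prod_append, hY, List.prod_flatten_map_of_idempotent hx hX hI,
    List.prod_flatten_map_of_idempotent hx hX hJ]
end
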